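/- Let g : [0,T] × ℝ^d → ℝ^d satisfy (g(t,x) - g(t,y))·(x - y) ≤ F(t)‖x - y‖² for an integrable F, and let γ : [0,T] → ℝ^d be square integrable. Suppose X, X' : [0,T] → ℝ^d are absolutely continuous with X(0) = X'(0) and d/dt (X - X')(t) = g(t,X(t)) - g(t,X'(t)) + γ(t) for a.e. t. Then sup_{0≤t≤T} ‖X(t) - X'(t)‖² ≤ (sup_{0≤t≤T} ∫_0^t exp(2∫_s^t F(u)du) ds) · ∫_0^T ‖γ(t)‖² dt. -/

import Mathlib

open MeasureTheory Set intervalIntegral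
open scoped RealInnerProductSpace

theorem AbsolutelyContinuousOnInterval.of_dist_le_mul {X Y : Type*} [PseudoMetricSpace X]
    [PseudoMetricSpace Y] {f : ℝ → X} {φ : ℝ → Y} {K a b : ℝ}
    (hf : AbsolutelyContinuousOnInterval f a b)
    (h : ∀ x ∈ uIcc a b, ∀ y ∈ uIcc a b, dist (φ x) (φ y) ≤ K * dist (f x) (f y)) :
    AbsolutelyContinuousOnInterval φ a b := by
  unfold AbsolutelyContinuousOnInterval at hf ⊢
  refine squeeze_zero' (Filter.Eventually.of_forall fun _ ↦ Finset.sum_nonneg fun _ _ ↦ dist_nonneg)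
    ?_ (by simpa using hf.const_mul K)
  rw [Filter.eventually_inf_principal]
  filter_upwards with E hE
  rw [Finset.mul_sum]
  exact Finset.sum_le_sum fun i hi ↦ h _ (hE.1 i hi).1 _ (hE.1 i hi).2

theorem AbsolutelyContinuousOnInterval.rexp {f : ℝ → ℝ} {a b : ℝ}
    (hf : AbsolutelyContinuousOnInterval f a b) :
    AbsolutelyContinuousOnInterval (fun x ↦ Real.exp (f x)) a b := by
  obtain ⟨C, hC⟩ := hf.exists_bound
  obtain ⟨K, hK⟩ := (Real.contDiff_exp (n := 1)).contDiffOn.exists_lipschitzOnWith one_ne_zero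
    (convex_Icc (-C) C) isCompact_Icc
  exact hf.of_dist_le_mul fun x hx y hy ↦
    hK.dist_le_mul _ (abs_le.1 (hC x hx)) _ (abs_le.1 (hC y hy))

theorem IntervalIntegrable.absolutelyContinuousOnInterval_norm_integral {E : Type*}
    [NormedAddCommGroup E] [NormedSpace ℝ E] {h : ℝ → E} {a b c : ℝ}
    (hh : IntervalIntegrable h volume a b) (hc : c ∈ uIcc a b) :
    AbsolutelyContinuousOnInterval (fun s ↦ ‖∫ u in c..s, h u‖) a b := by
  refine (hh.norm.absolutelyContinuousOnInterval_intervalIntegral hc).of_dist_le_mul (K := 1)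
    fun x hx y hy ↦ ?_
  have hx' := hh.mono_set (uIcc_subset_uIcc hc hx)
  have hy' := hh.mono_set (uIcc_subset_uIcc hc hy)
  rw [one_mul, dist_eq_norm, dist_eq_norm, integral_interval_sub_left hx'.norm hy'.norm]
  refine (abs_norm_sub_norm_le _ _).trans ?_
  rw [integral_interval_sub_left hx' hy']
  exact norm_integral_le_abs_integral_norm

/-- The Cauchy–Schwarz inequality for interval integrals. -/
theorem sq_intervalIntegral_mul_le {f g : ℝ → ℝ} {a b : ℝ} (hab : a ≤ b)
    (hf : IntervalIntegrable (fun x ↦ f x ^ 2) volume a b)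
    (hg : IntervalIntegrable (fun x ↦ g x ^ 2) volume a b)
    (hfg : IntervalIntegrable (fun x ↦ f x * g x) volume a b) :
    (∫ x in a..b, f x * g x) ^ 2 ≤ (∫ x in a..b, f x ^ 2) * ∫ x in a..b, g x ^ 2 := by
  have h := discrim_le_zero (a := ∫ x in a..b, f x ^ 2) (b := 2 * ∫ x in a..b, f x * g x)
    (c := ∫ x in a..b, g x ^ 2) fun r ↦ by
      have h₀ : 0 ≤ ∫ x in a..b, (r * f x + g x) ^ 2 :=
        integral_nonneg hab fun x _ ↦ sq_nonneg _
      have h₁ : ∫ x in a..b, (r * f x + g x) ^ 2 =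
          ∫ x in a..b, (r * r * f x ^ 2 + 2 * r * (f x * g x) + g x ^ 2) := by
        congr 1 with x; ring
      rw [h₁, integral_add ((hf.const_mul _).add (hfg.const_mul _)) hg,
        integral_add (hf.const_mul _) (hfg.const_mul _), intervalIntegral.integral_const_mul,
        intervalIntegral.integral_const_mul] at h₀
      linarith
  rw [discrim] at h
  linarith

/-- A differential inequality for `‖Z‖ ^ 2` passes to `‖Z‖`, also at the zeros of `Z`. -/
theorem HasDerivAt.norm_deriv_le {E : Type*} [NormedAddCommGroup E] [InnerProductSpace ℝ E]
    {Z : ℝ → E} {h : E} {n' k c x : ℝ} (hZ : HasDerivAt Z h x)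
    (hn : HasDerivAt (fun y ↦ ‖Z y‖) n' x) (hc : 0 ≤ c)
    (hle : ⟪h, Z x⟫ ≤ k * ‖Z x‖ ^ 2 + c * ‖Z x‖) : n' ≤ k * ‖Z x‖ + c := by
  rcases (norm_nonneg (Z x)).eq_or_lt with h0 | h0
  · have : IsLocalMin (fun y ↦ ‖Z y‖) x :=
      Filter.Eventually.of_forall fun y ↦ by simp [← h0]
    rw [this.hasDerivAt_eq_zero hn, ← h0]
    simpa using hc
  · have := (hn.pow 2).unique hZ.norm_sq
    rw [real_inner_comm] at this
    simp at this
    refine le_of_mul_le_mul_left ?_ h0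
    linarith

/-- Grönwall's inequality under a one-sided (dissipativity) bound on the integrand. -/
theorem norm_integral_le_of_inner_le {E : Type*} [NormedAddCommGroup E] [InnerProductSpace ℝ E]
    [CompleteSpace E] {h : ℝ → E} {F c : ℝ → ℝ} {a b : ℝ} (hab : a ≤ b)
    (hh : IntervalIntegrable h volume a b) (hF : IntervalIntegrable F volume a b)
    (hc : IntervalIntegrable c volume a b) (hc0 : ∀ s, 0 ≤ c s)
    (hle : ∀ s ∈ Icc a b, ⟪h s, ∫ u in a..s, h u⟫ ≤
      F s * ‖∫ u in a..s, h u‖ ^ 2 + c s * ‖∫ u in a..s, h u‖) :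
    ‖∫ s in a..b, h s‖ ≤ ∫ s in a..b, Real.exp (∫ u in s..b, F u) * c s := by
  have hb : b ∈ uIcc a b := right_mem_uIcc
  have ha : a ∈ uIcc a b := left_mem_uIcc
  have hn : AbsolutelyContinuousOnInterval (fun s ↦ ‖∫ u in a..s, h u‖) a b :=
    hh.absolutelyContinuousOnInterval_norm_integral ha
  have hA : AbsolutelyContinuousOnInterval (fun s ↦ ∫ u in s..b, F u) a b := by
    simp_rw [integral_symm b]
    exact (hF.absolutelyContinuousOnInterval_intervalIntegral hb).fun_neg
  have hw := hA.rexp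
  have hp := hw.fun_mul hn
  have key := hp.integral_deriv_eq_sub
  simp only [integral_same, Real.exp_zero, one_mul, norm_zero, mul_zero, sub_zero] at key
  rw [← key]
  refine integral_mono_ae_restrict hab hp.intervalIntegrable_deriv
    (hc.continuousOn_mul hw.continuousOn) ?_
  rw [Filter.EventuallyLE, ae_restrict_iff' measurableSet_Icc]
  filter_upwards [hn.ae_differentiableAt, hh.ae_hasDerivAt_integral, hF.ae_hasDerivAt_integral]
    with s h₁ h₂ h₃ hs
  have hs' : s ∈ uIcc a b := by rwa [uIcc_of_le hab]
  have d₁ := (h₁ hs').hasDerivAt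
  have d₃ : HasDerivAt (fun s ↦ ∫ u in s..b, F u) (-F s) s := by
    simp_rw [integral_symm b]
    exact (h₃ hs' b hb).fun_neg
  have := (h₂ hs' a ha).norm_deriv_le d₁ (hc0 s) (hle s hs)
  rw [(d₃.exp.fun_mul d₁).deriv]
  nlinarith [mul_le_mul_of_nonneg_left this (Real.exp_pos (∫ u in s..b, F u)).le]

/-- Deterministic core of the TCI proof without reflection: a one-sided Lipschitz
(monotone) drift `g` perturbed by `γ` gives
`sup_t ‖X t - X' t‖² ≤ (sup_t ∫_0^t exp(2∫_s^t F)) ∫_0^T ‖γ‖²`. -/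
theorem monotone_drift_stability (d : ℕ) (T : ℝ) (hT : 0 < T)
    (F : ℝ → ℝ) (hF : IntegrableOn F (Icc 0 T))
    (g : ℝ → EuclideanSpace ℝ (Fin d) → EuclideanSpace ℝ (Fin d))
    (hg : ∀ t ∈ Icc (0:ℝ) T, ∀ x y : EuclideanSpace ℝ (Fin d),
      ⟪g t x - g t y, x - y⟫ ≤ F t * ‖x - y‖ ^ 2)
    (γ : ℝ → EuclideanSpace ℝ (Fin d))
    (hγsq : IntegrableOn (fun t => ‖γ t‖ ^ 2) (Icc 0 T))
    (X X' : ℝ → EuclideanSpace ℝ (Fin d))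
    (h0 : X 0 = X' 0)
    (hode : ∀ t ∈ Icc (0:ℝ) T,
      X t - X' t = ∫ s in (0:ℝ)..t, (g s (X s) - g s (X' s) + γ s)) :
    ∀ t ∈ Icc (0:ℝ) T, ‖X t - X' t‖ ^ 2 ≤
      (⨆ t ∈ Icc (0:ℝ) T, ∫ s in (0:ℝ)..t, Real.exp (2 * ∫ u in s..t, F u)) *
        ∫ t in (0:ℝ)..T, ‖γ t‖ ^ 2 := by
  intro t ht
  have sub : ∀ {t}, t ∈ Icc (0:ℝ) T → uIcc 0 t ⊆ Icc 0 T := fun {t} ht ↦ by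
    rw [uIcc_of_le ht.1]; exact Icc_subset_Icc_right ht.2
  have hFi : ∀ {t}, t ∈ Icc (0:ℝ) T → IntervalIntegrable F volume 0 t := fun ht ↦
    (hF.mono_set (sub ht)).intervalIntegrable
  have hγi : ∀ {t}, t ∈ Icc (0:ℝ) T → IntervalIntegrable (fun t ↦ ‖γ t‖ ^ 2) volume 0 t :=
    fun ht ↦ (hγsq.mono_set (sub ht)).intervalIntegrable
  have hnn : ∀ t, 0 ≤ t → 0 ≤ ∫ s in (0:ℝ)..t, Real.exp (2 * ∫ u in s..t, F u) :=
    fun t h ↦ integral_nonneg h fun s _ ↦ (Real.exp_pos _).le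
  have hTm : T ∈ Icc (0:ℝ) T := right_mem_Icc.2 hT.le
  have hbdd : BddAbove (range fun t ↦ ⨆ _ : t ∈ Icc (0:ℝ) T,
      ∫ s in (0:ℝ)..t, Real.exp (2 * ∫ u in s..t, F u)) := by
    refine ⟨Real.exp (2 * ∫ u in (0:ℝ)..T, |F u|) * T, ?_⟩
    rintro _ ⟨r, rfl⟩
    refine Real.iSup_le (fun hr ↦ ?_) (by positivity)
    refine (Real.le_norm_self _).trans ((intervalIntegral.norm_integral_le_of_norm_le_const
      (C := Real.exp (2 * ∫ u in (0:ℝ)..T, |F u|)) fun s hs ↦ ?_).trans ?_)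
    · rw [uIoc_of_le hr.1] at hs
      rw [Real.norm_eq_abs, Real.abs_exp]
      gcongr
      calc ∫ u in s..r, F u ≤ ∫ u in s..r, |F u| :=
            (Real.le_norm_self _).trans (norm_integral_le_integral_norm hs.2)
        _ ≤ _ := integral_mono_interval hs.1.le hs.2 hr.2
            (Filter.Eventually.of_forall fun _ ↦ abs_nonneg _) (hFi hTm).abs
    · rw [sub_zero, abs_of_nonneg hr.1]
      exact mul_le_mul_of_nonneg_left hr.2 (Real.exp_pos _).le
  have hsup : ∫ s in (0:ℝ)..t, Real.exp (2 * ∫ u in s..t, F u) ≤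
      ⨆ t ∈ Icc (0:ℝ) T, ∫ s in (0:ℝ)..t, Real.exp (2 * ∫ u in s..t, F u) := by
    have := le_ciSup hbdd t
    rwa [ciSup_pos ht] at this
  have hγT : ∫ s in (0:ℝ)..t, ‖γ s‖ ^ 2 ≤ ∫ s in (0:ℝ)..T, ‖γ s‖ ^ 2 :=
    integral_mono_interval le_rfl ht.1 ht.2
      (Filter.Eventually.of_forall fun _ ↦ sq_nonneg _) (hγi hTm)
  have hγ0 : 0 ≤ ∫ s in (0:ℝ)..t, ‖γ s‖ ^ 2 := integral_nonneg ht.1 fun _ _ ↦ sq_nonneg _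
  refine le_trans ?_ (mul_le_mul hsup hγT hγ0 ((hnn t ht.1).trans hsup))
  -- If the right-hand side of the equation is not integrable on `0..t`, then `X t - X' t = 0`.
  by_cases hh : IntervalIntegrable (fun s ↦ g s (X s) - g s (X' s) + γ s) volume 0 t
  swap
  · rw [hode t ht, integral_undef hh]
    simpa using mul_nonneg (hnn t ht.1) hγ0
  have hγn : IntervalIntegrable (fun s ↦ ‖γ s‖) volume 0 t := by
    have hm : AEStronglyMeasurable (fun s ↦ ‖γ s‖) (volume.restrict (uIoc 0 t)) := by
      simpa using Real.continuous_sqrt.comp_aestronglyMeasurable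
        (hγi ht).def'.aestronglyMeasurable
    refine ((intervalIntegrable_const (c := (1:ℝ))).add (hγi ht)).mono_fun hm
      (Filter.Eventually.of_forall fun s ↦ ?_)
    simp only [Real.norm_eq_abs, abs_norm]
    exact le_trans (by nlinarith [sq_nonneg (‖γ s‖ - 1), sq_nonneg ‖γ s‖]) (le_abs_self _)
  have hmain := norm_integral_le_of_inner_le ht.1 hh (hFi ht) hγn (fun _ ↦ norm_nonneg _)
    fun s hs ↦ by
      have hs' : s ∈ Icc 0 T := ⟨hs.1, hs.2.trans ht.2⟩
      rw [← hode s hs', inner_add_left]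
      exact add_le_add (hg s hs' _ _) (real_inner_le_norm _ _)
  rw [← hode t ht] at hmain
  have hexp : ContinuousOn (fun s ↦ Real.exp (∫ u in s..t, F u)) (uIcc 0 t) := by
    simp_rw [integral_symm t]
    exact ((hFi ht).absolutelyContinuousOnInterval_intervalIntegral
      right_mem_uIcc).continuousOn.neg.rexp
  have hsq : ∀ s, Real.exp (2 * ∫ u in s..t, F u) = Real.exp (∫ u in s..t, F u) ^ 2 := fun s ↦ by
    rw [← Real.exp_nat_mul]; norm_num
  refine (pow_le_pow_left₀ (norm_nonneg _) hmain 2).trans ?_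
  simp_rw [hsq]
  exact sq_intervalIntegral_mul_le ht.1 (hexp.pow 2).intervalIntegrable (hγi ht)
    (hγn.continuousOn_mul hexp)
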